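/- arXiv:1912.00545 — 3 statements merged into one kernel-verified Lean document; each statement's English description precedes it below -/
import Mathlib

section
/- Under the semi-discrete polygonal evolution law ∂_t X_i = V_i N_i + W_i T_i, the time derivative of the total length satisfies ∂_t L = 2 Σ_{i=1}^N sin(φ_i/2) V_i; in particular it does not depend on the tangential velocities W_i. -/
open Real

/-- Euclidean norm on the plane `ℝ × ℝ`. -/
noncomputable def norm2 (p : ℝ × ℝ) : ℝ := Real.sqrt (p.1 ^ 2 + p.2 ^ 2)

/-- Rotation by `π/2`: `J(a,b) = (-b,a)`. -/
def Jrot (p : ℝ × ℝ) : ℝ × ℝ := (-p.2, p.1)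

/-- Euclidean dot product on the plane `ℝ × ℝ`. -/
def dot (p q : ℝ × ℝ) : ℝ := p.1 * q.1 + p.2 * q.2

/-- The Euclidean norm of a differentiable nonvanishing plane curve has as derivative the
component of the velocity along the unit direction. -/
theorem hasDerivAt_norm2 {f : ℝ → ℝ × ℝ} {f' : ℝ × ℝ} {t : ℝ}
    (hf : HasDerivAt f f' t) (h0 : f t ≠ 0) :
    HasDerivAt (fun s => norm2 (f s)) (dot ((norm2 (f t))⁻¹ • f t) f') t := by
  have h1 : HasDerivAt (fun s => (f s).1) f'.1 t := hf.fst
  have h2 : HasDerivAt (fun s => (f s).2) f'.2 t := hf.snd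
  have hne : (f t).1 ^ 2 + (f t).2 ^ 2 ≠ 0 := by
    intro h
    apply h0
    ext
    · exact pow_eq_zero_iff two_ne_zero |>.mp (by nlinarith [sq_nonneg (f t).1, sq_nonneg (f t).2])
    · exact pow_eq_zero_iff two_ne_zero |>.mp (by nlinarith [sq_nonneg (f t).1, sq_nonneg (f t).2])
  refine (((h1.pow 2).add (h2.pow 2)).sqrt hne).congr_deriv ?_
  have hpos : √((f t).1 ^ 2 + (f t).2 ^ 2) ≠ 0 := by positivity
  simp only [dot, norm2, Prod.smul_fst, Prod.smul_snd, smul_eq_mul, Pi.add_apply, Pi.pow_apply]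
  field_simp
  ring

/-- Rotating by `φ` changes the unit vector at angle `θ` along the normal at the half angle. -/
theorem dot_unit_sub_dot_unit (θ φ V W : ℝ) (T : ℝ × ℝ)
    (hT : T = (cos (θ + φ / 2), sin (θ + φ / 2))) :
    dot (cos θ, sin θ) (V • -Jrot T + W • T)
      - dot (cos (θ + φ), sin (θ + φ)) (V • -Jrot T + W • T) = 2 * (sin (φ / 2) * V) := by
  obtain ⟨ψ, rfl⟩ : ∃ ψ, θ = ψ - φ / 2 := ⟨θ + φ / 2, by ring⟩
  have hadd : ψ - φ / 2 + φ = ψ + φ / 2 := by ring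
  subst hT
  simp only [dot, Jrot, sub_add_cancel, hadd, cos_sub, sin_sub, cos_add, sin_add, Prod.fst_add,
    Prod.snd_add, Prod.smul_fst, Prod.smul_snd, Prod.fst_neg, Prod.snd_neg, smul_eq_mul]
  linear_combination (2 * sin (φ / 2) * V) * sin_sq_add_cos_sq ψ

/-- Under the semi-discrete polygonal evolution law `∂ₜ Xᵢ = Vᵢ Nᵢ + Wᵢ Tᵢ`,
the total length `L = Σ rᵢ` satisfies `∂ₜ L = 2 Σ sin(φᵢ/2) Vᵢ`. -/
theorem polygon_length_derivative
    (N : ℕ) [NeZero N] (hN : 3 ≤ N)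
    (X : ℝ → ZMod N → ℝ × ℝ)
    (r θ φ V W : ℝ → ZMod N → ℝ)
    (tv nv Tv Nv : ℝ → ZMod N → ℝ × ℝ)
    (hX : ∀ t i, X t i ≠ X t (i - 1))
    (hr : ∀ t i, r t i = norm2 (X t i - X t (i - 1)))
    (htv : ∀ t i, tv t i = (r t i)⁻¹ • (X t i - X t (i - 1)))
    (hnv : ∀ t i, nv t i = -Jrot (tv t i))
    (hθ : ∀ t i, tv t i = (cos (θ t i), sin (θ t i)))
    (hφmem : ∀ t i, φ t i ∈ Set.Ioo (-π) π)
    (hφ : ∀ t i, tv t (i + 1) = (cos (θ t i + φ t i), sin (θ t i + φ t i)))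
    (hTv : ∀ t i, Tv t i = (cos (θ t i + φ t i / 2), sin (θ t i + φ t i / 2)))
    (hNv : ∀ t i, Nv t i = -Jrot (Tv t i))
    (hevol : ∀ t i, HasDerivAt (fun s => X s i) (V t i • Nv t i + W t i • Tv t i) t)
    (t : ℝ) :
    HasDerivAt (fun s => ∑ i, r s i) (2 * ∑ i, sin (φ t i / 2) * V t i) t := by
  have hedge : ∀ i, HasDerivAt (fun s => r s i)
      (dot (tv t i) (V t i • Nv t i + W t i • Tv t i)
        - dot (tv t i) (V t (i - 1) • Nv t (i - 1) + W t (i - 1) • Tv t (i - 1))) t := by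
    intro i
    simp only [hr]
    refine (hasDerivAt_norm2 ((hevol t i).sub (hevol t (i - 1)))
      (sub_ne_zero.mpr (hX t i))).congr_deriv ?_
    simp only [htv t i, hr t i, dot, Pi.sub_apply, Prod.fst_sub, Prod.snd_sub]
    ring
  refine (HasDerivAt.fun_sum fun i _ => hedge i).congr_deriv ?_
  have hshift : ∑ i, dot (tv t i) (V t (i - 1) • Nv t (i - 1) + W t (i - 1) • Tv t (i - 1))
      = ∑ i, dot (tv t (i + 1)) (V t i • Nv t i + W t i • Tv t i) := by
    rw [← Equiv.sum_comp (Equiv.addRight (1 : ZMod N))]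
    simp
  rw [Finset.sum_sub_distrib, hshift, ← Finset.sum_sub_distrib, Finset.mul_sum]
  refine Finset.sum_congr rfl fun i _ => ?_
  rw [hφ, hθ, hNv]
  exact dot_unit_sub_dot_unit _ _ _ _ _ (hTv t i)
end

section
/- If, in addition to the semi-discrete polygonal evolution law ∂_t X_i = V_i N_i + W_i T_i with V_i = (v_i + v_{i+1})/(2 cos(φ_i/2)), the vertices remain uniformly distributed, i.e., r_i(t) = L(t)/N for all i and all t, then ∂_t L = Σ_{i=1}^N κ_i v_i r_i and ∂_t A = Σ_{i=1}^N v_i r_i (the error term in the area evolution vanishes). -/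
open Real

theorem norm2_pos {p : ℝ × ℝ} (hp : p ≠ 0) : 0 < norm2 p := by
  apply Real.sqrt_pos.2
  by_contra! h
  have h1 : p.1 = 0 := by nlinarith [sq_nonneg p.1, sq_nonneg p.2]
  have h2 : p.2 = 0 := by nlinarith [sq_nonneg p.1, sq_nonneg p.2]
  exact hp (Prod.ext h1 h2)

theorem HasDerivAt.prod_fst {p : ℝ → ℝ × ℝ} {p' : ℝ × ℝ} {t : ℝ} (h : HasDerivAt p p' t) :
    HasDerivAt (fun s => (p s).1) p'.1 t :=
  (ContinuousLinearMap.fst ℝ ℝ ℝ).hasFDerivAt.comp_hasDerivAt t h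

theorem HasDerivAt.prod_snd {p : ℝ → ℝ × ℝ} {p' : ℝ × ℝ} {t : ℝ} (h : HasDerivAt p p' t) :
    HasDerivAt (fun s => (p s).2) p'.2 t :=
  (ContinuousLinearMap.snd ℝ ℝ ℝ).hasFDerivAt.comp_hasDerivAt t h

theorem HasDerivAt.norm2 {p : ℝ → ℝ × ℝ} {p' : ℝ × ℝ} {t : ℝ} (h : HasDerivAt p p' t)
    (hp : p t ≠ 0) : HasDerivAt (fun s => norm2 (p s)) (dot (p t) p' / norm2 (p t)) t := by
  have hpos : 0 < (p t).1 ^ 2 + (p t).2 ^ 2 := Real.sqrt_pos.1 (norm2_pos hp)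
  refine (((h.prod_fst.pow 2).add (h.prod_snd.pow 2)).sqrt hpos.ne').congr_deriv ?_
  have hne := (norm2_pos hp).ne'
  simp only [_root_.norm2, dot, Pi.add_apply, Pi.pow_apply] at hne ⊢
  field_simp
  ring

theorem HasDerivAt.dot_Jrot {p q : ℝ → ℝ × ℝ} {p' q' : ℝ × ℝ} {t : ℝ}
    (hp : HasDerivAt p p' t) (hq : HasDerivAt q q' t) :
    HasDerivAt (fun s => dot (Jrot (p s)) (q s))
      (dot (Jrot p') (q t) + dot (Jrot (p t)) q') t := by
  refine ((hp.prod_snd.neg.mul hq.prod_fst).add (hp.prod_fst.mul hq.prod_snd)).congr_deriv ?_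
  simp only [dot, Jrot, Pi.neg_apply]
  ring

/-- A cyclic sum is invariant under shifting the index back by one. -/
theorem ZMod.sum_sub_one {N : ℕ} [NeZero N] (f : ZMod N → ℝ) : ∑ i, f (i - 1) = ∑ i, f i :=
  Equiv.sum_comp (Equiv.subRight (1 : ZMod N)) f

/-- A cyclic sum is invariant under shifting the index forward by one. -/
theorem ZMod.sum_add_one {N : ℕ} [NeZero N] (f : ZMod N → ℝ) : ∑ i, f (i + 1) = ∑ i, f i :=
  Equiv.sum_comp (Equiv.addRight (1 : ZMod N)) f

/-- Component, along the direction `α`, of a velocity given in the frame of direction `β`. -/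
theorem dot_frame (α β V W : ℝ) :
    dot (cos α, sin α) (V • -Jrot (cos β, sin β) + W • (cos β, sin β)) =
      V * sin (β - α) + W * cos (β - α) := by
  simp only [dot, Jrot, sin_sub, cos_sub, Prod.fst_add, Prod.snd_add, Prod.smul_fst,
    Prod.smul_snd, Prod.fst_neg, Prod.snd_neg, smul_eq_mul]
  ring

/-- Component, along the outer normal of the direction `α`, of a velocity given in the frame of
direction `β`. -/
theorem dot_neg_Jrot_frame (α β V W : ℝ) :
    dot (-Jrot (cos α, sin α)) (V • -Jrot (cos β, sin β) + W • (cos β, sin β)) =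
      V * cos (β - α) - W * sin (β - α) := by
  simp only [dot, Jrot, sin_sub, cos_sub, Prod.fst_add, Prod.snd_add, Prod.smul_fst,
    Prod.smul_snd, Prod.fst_neg, Prod.snd_neg, smul_eq_mul]
  ring

/-- Summation by parts for the first variation of the area of a closed polygon. -/
theorem sum_dot_Jrot_variation {N : ℕ} [NeZero N] (X Y : ZMod N → ℝ × ℝ) :
    ∑ i, (dot (Jrot (Y (i - 1))) (X i) + dot (Jrot (X (i - 1))) (Y i)) =
      ∑ i, (dot (-Jrot (X i - X (i - 1))) (Y i) + dot (-Jrot (X (i + 1) - X i)) (Y i)) := by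
  have h := ZMod.sum_sub_one fun i => dot (Jrot (Y i)) (X (i + 1))
  simp only [sub_add_cancel] at h
  rw [Finset.sum_add_distrib, h, ← Finset.sum_add_distrib]
  refine Finset.sum_congr rfl fun i _ => ?_
  simp only [dot, Jrot, Prod.fst_neg, Prod.snd_neg, Prod.fst_sub, Prod.snd_sub]
  ring

/-- If the vertices remain uniformly distributed, `rᵢ(t) = L(t)/N`, then under the
semi-discrete polygonal evolution law with `Vᵢ = (vᵢ + vᵢ₊₁)/(2 cos(φᵢ/2))` one has
`∂ₜ L = Σ κᵢ vᵢ rᵢ` and `∂ₜ A = Σ vᵢ rᵢ`. -/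
theorem polygon_uniform_length_area_derivative
    (N : ℕ) [NeZero N] (hN : 3 ≤ N)
    (X : ℝ → ZMod N → ℝ × ℝ)
    (r θ φ V W : ℝ → ZMod N → ℝ)
    (tv nv Tv Nv : ℝ → ZMod N → ℝ × ℝ)
    (hX : ∀ t i, X t i ≠ X t (i - 1))
    (hr : ∀ t i, r t i = norm2 (X t i - X t (i - 1)))
    (htv : ∀ t i, tv t i = (r t i)⁻¹ • (X t i - X t (i - 1)))
    (hnv : ∀ t i, nv t i = -Jrot (tv t i))
    (hθ : ∀ t i, tv t i = (cos (θ t i), sin (θ t i)))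
    (hφmem : ∀ t i, φ t i ∈ Set.Ioo (-π) π)
    (hφ : ∀ t i, tv t (i + 1) = (cos (θ t i + φ t i), sin (θ t i + φ t i)))
    (hTv : ∀ t i, Tv t i = (cos (θ t i + φ t i / 2), sin (θ t i + φ t i / 2)))
    (hNv : ∀ t i, Nv t i = -Jrot (Tv t i))
    (hevol : ∀ t i, HasDerivAt (fun s => X s i) (V t i • Nv t i + W t i • Tv t i) t)
    (κ v : ℝ → ZMod N → ℝ)
    (hκ : ∀ t i, κ t i = (tan (φ t i / 2) + tan (φ t (i - 1) / 2)) / r t i)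
    (hV : ∀ t i, V t i = (v t i + v t (i + 1)) / (2 * cos (φ t i / 2)))
    (huni : ∀ t i, r t i = (∑ j, r t j) / (N : ℝ))
    (t : ℝ) :
    HasDerivAt (fun s => ∑ i, r s i) (∑ i, κ t i * v t i * r t i) t
    ∧ HasDerivAt (fun s => (1 / 2) * ∑ i, dot (Jrot (X s (i - 1))) (X s i))
        (∑ i, v t i * r t i) t := by
  have hrpos : ∀ i, 0 < r t i := fun i => by
    rw [hr]; exact norm2_pos (sub_ne_zero.2 (hX t i))
  have hcos : ∀ i, 0 < cos (φ t i / 2) := fun i => by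
    have h := hφmem t i
    exact cos_pos_of_mem_Ioo ⟨by linarith [h.1], by linarith [h.2]⟩
  have hedge : ∀ i, X t i - X t (i - 1) = r t i • tv t i := fun i => by
    rw [htv, smul_inv_smul₀ (hrpos i).ne']
  have hvel : ∀ i, 2 * V t i * cos (φ t i / 2) = v t i + v t (i + 1) := fun i => by
    have := (hcos i).ne'
    rw [hV]; field_simp
  set Y : ZMod N → ℝ × ℝ := fun i => V t i • Nv t i + W t i • Tv t i with hY
  have hYframe : ∀ i, Y i = V t i • -Jrot (cos (θ t i + φ t i / 2), sin (θ t i + φ t i / 2)) +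
      W t i • (cos (θ t i + φ t i / 2), sin (θ t i + φ t i / 2)) := fun i => by
    simp only [hY, hNv, hTv]
  have hback : ∀ i, θ t i + φ t i / 2 - θ t i = φ t i / 2 := fun i => by ring
  have hfwd : ∀ i, θ t i + φ t i / 2 - (θ t i + φ t i) = -(φ t i / 2) := fun i => by ring
  constructor
  · have hdot : ∀ p q : ℝ × ℝ, ∀ c : ℝ, dot (c • p) q = c * dot p q := fun p q c => by
      simp only [dot, Prod.smul_fst, Prod.smul_snd, smul_eq_mul]; ring
    have hder : ∀ i, HasDerivAt (fun s => r s i) (dot (tv t i) (Y i - Y (i - 1))) t := fun i => by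
      have h := ((hevol t i).sub (hevol t (i - 1))).norm2 (sub_ne_zero.2 (hX t i))
      simp only [Pi.sub_apply, ← hr] at h
      rwa [hedge, hdot, mul_div_cancel_left₀ _ (hrpos i).ne'] at h
    refine (HasDerivAt.fun_sum fun i _ => hder i).congr_deriv ?_
    have hsplit : ∀ i, dot (tv t i) (Y i - Y (i - 1)) =
        dot (tv t i) (Y i) - dot (tv t (i - 1 + 1)) (Y (i - 1)) := fun i => by
      rw [sub_add_cancel]
      simp only [dot, Prod.fst_sub, Prod.snd_sub]; ring
    have hκr : ∀ i, κ t i * v t i * r t i =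
        tan (φ t i / 2) * v t i + tan (φ t (i - 1) / 2) * v t (i - 1 + 1) := fun i => by
      have := (hrpos i).ne'
      rw [hκ, sub_add_cancel]; field_simp
    simp only [hsplit, hκr]
    rw [Finset.sum_sub_distrib, Finset.sum_add_distrib,
      ZMod.sum_sub_one fun i => dot (tv t (i + 1)) (Y i),
      ZMod.sum_sub_one fun i => tan (φ t i / 2) * v t (i + 1),
      ← Finset.sum_sub_distrib, ← Finset.sum_add_distrib]
    refine Finset.sum_congr rfl fun i _ => ?_
    rw [hθ, hφ, hYframe, dot_frame, dot_frame, hback, hfwd, sin_neg, cos_neg, ← mul_add, ← hvel]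
    have := (hcos i).ne'
    rw [tan_eq_sin_div_cos]; field_simp
    ring
  · have hder := (HasDerivAt.fun_sum fun i (_ : i ∈ Finset.univ) =>
      (hevol t (i - 1)).dot_Jrot (hevol t i)).const_mul (1 / 2)
    refine hder.congr_deriv ?_
    have hR : ∀ i, r t (i + 1) = r t i := fun i => by rw [huni t (i + 1), ← huni t i]
    have hdot : ∀ p q : ℝ × ℝ, ∀ c : ℝ, dot (-Jrot (c • p)) q = c * dot (-Jrot p) q :=
      fun p q c => by
        simp only [dot, Jrot, Prod.fst_neg, Prod.snd_neg, Prod.smul_fst, Prod.smul_snd,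
          smul_eq_mul]
        ring
    have hnext : ∀ i, X t (i + 1) - X t i = r t i • tv t (i + 1) := fun i => by
      have h := hedge (i + 1)
      rwa [add_sub_cancel_right, hR] at h
    have hterm : ∀ i, dot (-Jrot (X t i - X t (i - 1))) (Y i) +
        dot (-Jrot (X t (i + 1) - X t i)) (Y i) =
          v t i * r t i + v t (i + 1) * r t (i + 1) := fun i => by
      rw [hedge, hnext, hdot, hdot, hθ, hφ, hYframe, dot_neg_Jrot_frame, dot_neg_Jrot_frame,
        hback, hfwd, sin_neg, cos_neg, hR]
      linear_combination r t i * hvel i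
    have hsum := sum_dot_Jrot_variation (X t) Y
    simp only [hterm] at hsum
    rw [Finset.sum_add_distrib (f := fun i => v t i * r t i),
      ZMod.sum_add_one fun i => v t i * r t i] at hsum
    linear_combination (1 / 2) * hsum
end

section
/- Under the fully discrete polygonal evolution law (X_i − X̂_i)/Δt = V̄_i N̄_i + W̄_i T̄_i, with D_{i+1} − D_i = F̄_i N̄_i + Ḡ_i T̄_i, the change of length satisfies (L − L̂)/Δt = −Σ_{i=1}^N F̄_i V̄_i − Σ_{i=1}^N Ḡ_i W̄_i. -/
open Real

theorem norm2_sq (p : ℝ × ℝ) : norm2 p ^ 2 = dot p p := by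
  rw [norm2, Real.sq_sqrt (by positivity), dot]
  ring

theorem norm2_sub_norm2 {p q : ℝ × ℝ} (hp : p ≠ 0) :
    norm2 p - norm2 q = dot ((norm2 p + norm2 q)⁻¹ • (p + q)) (p - q) := by
  have hsum : norm2 p + norm2 q ≠ 0 :=
    (add_pos_of_pos_of_nonneg (norm2_pos hp) (Real.sqrt_nonneg _)).ne'
  have hdot : dot ((norm2 p + norm2 q)⁻¹ • (p + q)) (p - q)
      = (norm2 p + norm2 q)⁻¹ * (norm2 p ^ 2 - norm2 q ^ 2) := by
    simp only [norm2_sq, dot, Prod.smul_fst, Prod.smul_snd, Prod.fst_add, Prod.snd_add,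
      Prod.fst_sub, Prod.snd_sub, smul_eq_mul]
    ring
  rw [hdot]
  field_simp
  ring

/-- Coordinates with respect to the frame `n, J n` of a unit vector `n` are orthonormal. -/
theorem dot_frame_s16 {n : ℝ × ℝ} (hn : norm2 n = 1) (a b c d : ℝ) :
    dot (a • n + b • Jrot n) (c • n + d • Jrot n) = a * c + b * d := by
  have h : n.1 * n.1 + n.2 * n.2 = 1 := by
    have := norm2_sq n
    rw [hn, dot] at this
    linarith
  simp only [dot, Jrot, Prod.smul_fst, Prod.smul_snd, Prod.fst_add, Prod.snd_add, smul_eq_mul]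
  linear_combination (a * c + b * d) * h

/-- Summation by parts on a cycle. -/
theorem sum_dot_sub_shift {N : ℕ} [NeZero N] (D Y : ZMod N → ℝ × ℝ) :
    ∑ i, dot (D i) (Y i - Y (i - 1)) = -∑ i, dot (D (i + 1) - D i) (Y i) := by
  have hshift : ∑ i, dot (D (i + 1)) (Y i) = ∑ i, dot (D i) (Y (i - 1)) :=
    Fintype.sum_equiv (Equiv.addRight 1) _ _ fun i => by simp
  have hright (i : ZMod N) :
      dot (D i) (Y i - Y (i - 1)) = dot (D i) (Y i) - dot (D i) (Y (i - 1)) := by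
    simp only [dot, Prod.fst_sub, Prod.snd_sub]
    ring
  have hleft (i : ZMod N) :
      dot (D (i + 1) - D i) (Y i) = dot (D (i + 1)) (Y i) - dot (D i) (Y i) := by
    simp only [dot, Prod.fst_sub, Prod.snd_sub]
    ring
  simp only [hright, hleft, Finset.sum_sub_distrib, hshift]
  ring

/-- Under the fully discrete polygonal evolution law
`(Xᵢ − X̂ᵢ)/Δt = V̄ᵢ N̄ᵢ + W̄ᵢ T̄ᵢ`, with `Dᵢ₊₁ − Dᵢ = F̄ᵢ N̄ᵢ + Ḡᵢ T̄ᵢ`,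
the change of length satisfies `(L − L̂)/Δt = −Σ F̄ᵢ V̄ᵢ − Σ Ḡᵢ W̄ᵢ`. -/
theorem fully_discrete_length_difference
    (N : ℕ) [NeZero N] (hN : 3 ≤ N)
    (X Xh : ZMod N → ℝ × ℝ)
    (hX : ∀ i, X i ≠ X (i - 1)) (hXh : ∀ i, Xh i ≠ Xh (i - 1))
    (r rh : ZMod N → ℝ)
    (hr : ∀ i, r i = norm2 (X i - X (i - 1)))
    (hrh : ∀ i, rh i = norm2 (Xh i - Xh (i - 1)))
    (Xb : ZMod N → ℝ × ℝ)
    (hXb : ∀ i, Xb i = (1 / 2 : ℝ) • (X i + Xh i))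
    (D : ZMod N → ℝ × ℝ)
    (hD : ∀ i, D i = (2 / (r i + rh i)) • (Xb i - Xb (i - 1)))
    (Δt : ℝ) (hΔt : 0 < Δt)
    (Nb Tb : ZMod N → ℝ × ℝ)
    (hNb : ∀ i, norm2 (Nb i) = 1)
    (hTb : ∀ i, Tb i = Jrot (Nb i))
    (Fb Gb : ZMod N → ℝ)
    (hFG : ∀ i, D (i + 1) - D i = Fb i • Nb i + Gb i • Tb i)
    (Vb Wb : ZMod N → ℝ)
    (hevol : ∀ i, Δt⁻¹ • (X i - Xh i) = Vb i • Nb i + Wb i • Tb i) :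
    ((∑ i, r i) - ∑ i, rh i) / Δt = -(∑ i, Fb i * Vb i) - ∑ i, Gb i * Wb i := by
  have hedge (i : ZMod N) : (r i - rh i) / Δt
      = dot (D i) (Δt⁻¹ • (X i - Xh i) - Δt⁻¹ • (X (i - 1) - Xh (i - 1))) := by
    rw [hD, hXb, hXb, hr, hrh, norm2_sub_norm2 (sub_ne_zero.mpr (hX i))]
    simp only [dot, Prod.smul_fst, Prod.smul_snd, Prod.fst_add, Prod.snd_add,
      Prod.fst_sub, Prod.snd_sub, smul_eq_mul]
    ring
  have hframe (i : ZMod N) :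
      dot (D (i + 1) - D i) (Δt⁻¹ • (X i - Xh i)) = Fb i * Vb i + Gb i * Wb i := by
    rw [hFG, hevol, hTb, dot_frame_s16 (hNb i)]
  rw [← Finset.sum_sub_distrib, Finset.sum_div, Finset.sum_congr rfl fun i _ => hedge i,
    sum_dot_sub_shift D fun i => Δt⁻¹ • (X i - Xh i)]
  simp only [hframe, Finset.sum_add_distrib]
  ring
end
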